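/- Suppose V(·,s) → V̄ and B(·,s) → B̄ in H¹(B_R) for every R > 0 as s → ∞, where (V,B) solve the self-similar MHD evolution system ½V_s + ½V + ½(y·∇)V + (V·∇)V = νΔV + (B·∇)B − ∇P', ½B_s + ½B + ½(y·∇)B + (V·∇)B = (B·∇)V with div V = div B = 0, and V̄, B̄ ∈ C¹(ℝⁿ). Then (V̄, B̄) is a weak (distributional) solution of the stationary system: for every divergence-free φ ∈ C¹_c(ℝⁿ; ℝⁿ), ∫ [V̄ + (y·∇)V̄ + 2(V̄·∇)V̄ − 2(B̄·∇)B̄]·φ dy + 2ν ∫ ∇V̄·∇φ dy = 0, and for every ψ ∈ C¹_c(ℝⁿ), ∫ [B̄ + (y·∇)B̄ + 2(V̄·∇)B̄ − 2(B̄·∇)V̄] ψ dy = 0. -/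

import Mathlib

open MeasureTheory Real Filter
open scoped RealInnerProductSpace Topology

noncomputable section

def ediv {n : ℕ} (f : EuclideanSpace ℝ (Fin n) → EuclideanSpace ℝ (Fin n))
    (x : EuclideanSpace ℝ (Fin n)) : ℝ :=
  ∑ i, fderiv ℝ f x (EuclideanSpace.single i 1) i

def elap {n : ℕ} (f : EuclideanSpace ℝ (Fin n) → EuclideanSpace ℝ (Fin n))
    (x : EuclideanSpace ℝ (Fin n)) : EuclideanSpace ℝ (Fin n) :=
  ∑ i, fderiv ℝ (fun y => fderiv ℝ f y (EuclideanSpace.single i 1)) x (EuclideanSpace.single i 1)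

lemma aux_limit {f g : ℝ → ℝ} {a b : ℝ} (h : ∀ s > 0, HasDerivAt f (g s) s)
    (hf : Tendsto f atTop (𝓝 a)) (hg : Tendsto g atTop (𝓝 b)) : b = 0 := by
  have key : ∀ k : ℕ, ∃ c : ℝ, (k : ℝ) + 1 < c ∧ g c = f (k + 1 + 1) - f (k + 1) := by
    intro k
    have hk : (0 : ℝ) ≤ k := k.cast_nonneg
    obtain ⟨c, hc, h1⟩ := exists_hasDerivAt_eq_slope f g (a := (k : ℝ) + 1) (b := (k : ℝ) + 1 + 1)
      (by linarith)
      (fun x hx => (h x (by linarith [hx.1])).continuousAt.continuousWithinAt)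
      (fun x hx => h x (by linarith [hx.1]))
    refine ⟨c, hc.1, ?_⟩
    rw [h1]; simp
  choose c hc1 hc2 using key
  have hn : Tendsto (fun k : ℕ => (k : ℝ) + 1) atTop atTop :=
    tendsto_atTop_add_const_right _ _ tendsto_natCast_atTop_atTop
  have hct : Tendsto c atTop atTop := tendsto_atTop_mono (fun k => (hc1 k).le) hn
  have h1 := hg.comp hct
  have h2 : Tendsto (g ∘ c) atTop (𝓝 (a - a)) := by
    have : g ∘ c = fun k : ℕ => f (k + 1 + 1) - f (k + 1) := funext hc2
    rw [this]
    exact (hf.comp (tendsto_atTop_add_const_right _ 1 hn)).sub (hf.comp hn)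
  simpa using tendsto_nhds_unique h1 h2

lemma aux_int {n : ℕ} {f φ : EuclideanSpace ℝ (Fin n) → EuclideanSpace ℝ (Fin n)}
    (hf : Continuous f) (hφ : Continuous φ) (hc : HasCompactSupport φ) :
    Integrable (fun y => ⟪f y, φ y⟫) := by
  refine (hf.inner hφ).integrable_of_hasCompactSupport ?_
  refine hc.mono ?_
  intro y hy h0
  apply hy
  simp [h0]

lemma aux_deriv {n : ℕ} {W : ℝ → EuclideanSpace ℝ (Fin n) → EuclideanSpace ℝ (Fin n)}
    (hW : ContDiff ℝ 2 (fun q : ℝ × EuclideanSpace ℝ (Fin n) => W q.1 q.2))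
    {φ : EuclideanSpace ℝ (Fin n) → EuclideanSpace ℝ (Fin n)}
    (hφ : Continuous φ) (hc : HasCompactSupport φ) (s : ℝ) :
    HasDerivAt (fun s => ∫ y, ⟪W s y, φ y⟫) (∫ y, ⟪deriv (fun σ => W σ y) s, φ y⟫) s := by
  have hd : ∀ t y, HasDerivAt (fun σ => W σ y)
      (fderiv ℝ (fun q : ℝ × EuclideanSpace ℝ (Fin n) => W q.1 q.2) (t, y) (1, 0)) t := by
    intro t y
    have h1 := ((hW.differentiable (by norm_num)) (t, y)).hasFDerivAt
    have h2 : HasDerivAt (fun σ : ℝ => (σ, y)) ((1 : ℝ), (0 : EuclideanSpace ℝ (Fin n))) t :=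
      (hasDerivAt_id t).prodMk (hasDerivAt_const t y)
    exact h1.comp_hasDerivAt t h2
  have hcont : Continuous (fun q : ℝ × EuclideanSpace ℝ (Fin n) =>
      fderiv ℝ (fun q : ℝ × EuclideanSpace ℝ (Fin n) => W q.1 q.2) q (1, 0)) :=
    (hW.continuous_fderiv (by norm_num)).clm_apply continuous_const
  have hcont' : Continuous (fun q : ℝ × EuclideanSpace ℝ (Fin n) =>
      ⟪deriv (fun σ => W σ q.2) q.1, φ q.2⟫) := by
    have : (fun q : ℝ × EuclideanSpace ℝ (Fin n) => deriv (fun σ => W σ q.2) q.1) =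
      fun q => fderiv ℝ (fun q : ℝ × EuclideanSpace ℝ (Fin n) => W q.1 q.2) q (1, 0) :=
      funext fun q => (hd q.1 q.2).deriv
    have h : Continuous (fun q : ℝ × EuclideanSpace ℝ (Fin n) => deriv (fun σ => W σ q.2) q.1) :=
      this ▸ hcont
    exact h.inner (hφ.comp continuous_snd)
  have hWs : ∀ t, Continuous (W t) := fun t => hW.continuous.comp (Continuous.prodMk_right t)
  obtain ⟨C, hC⟩ := ((isCompact_Icc (a := s - 1) (b := s + 1)).prod hc.isCompact).exists_bound_of_continuousOn
    hcont'.continuousOn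
  refine (hasDerivAt_integral_of_dominated_loc_of_deriv_le
    (F := fun s y => ⟪W s y, φ y⟫) (F' := fun s y => ⟪deriv (fun σ => W σ y) s, φ y⟫)
    (bound := (tsupport φ).indicator fun _ => C)
    (s := Set.Icc (s - 1) (s + 1)) (Icc_mem_nhds (by linarith) (by linarith))
    (Eventually.of_forall fun t => ((hWs t).inner hφ).aestronglyMeasurable)
    (aux_int (hWs s) hφ hc)
    (hcont'.comp (Continuous.prodMk_right s)).aestronglyMeasurable
    (Eventually.of_forall fun y t ht => ?_) ?_ (Eventually.of_forall fun y t ht => ?_)).2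
  · by_cases hy : y ∈ tsupport φ
    · rw [Set.indicator_of_mem hy]
      exact hC (t, y) ⟨ht, hy⟩
    · rw [Set.indicator_of_notMem hy, image_eq_zero_of_notMem_tsupport hy]
      simp
  · rw [integrable_indicator_iff (isClosed_tsupport _).measurableSet]
    exact integrableOn_const hc.isCompact.measure_lt_top.ne
  · have := (hd t y)
    rw [← this.deriv] at this
    have h3 := this.inner ℝ (hasDerivAt_const t (φ y))
    simpa using h3

lemma aux_tendsto {n : ℕ}
    {L : ℝ → EuclideanSpace ℝ (Fin n) → EuclideanSpace ℝ (Fin n) →L[ℝ] EuclideanSpace ℝ (Fin n)}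
    {w : ℝ → EuclideanSpace ℝ (Fin n) → EuclideanSpace ℝ (Fin n)}
    {Lb : EuclideanSpace ℝ (Fin n) → EuclideanSpace ℝ (Fin n) →L[ℝ] EuclideanSpace ℝ (Fin n)}
    {wb φ : EuclideanSpace ℝ (Fin n) → EuclideanSpace ℝ (Fin n)}
    (hL : ∀ s, Continuous (L s)) (hw : ∀ s, Continuous (w s)) (hLb : Continuous Lb)
    (hwb : Continuous wb) (hφ : Continuous φ) (hc : HasCompactSupport φ)
    (cL : ∀ R > (0 : ℝ), Tendsto (fun s => ∫ y in Metric.ball (0 : EuclideanSpace ℝ (Fin n)) R,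
      ‖L s y - Lb y‖ ^ 2) atTop (𝓝 0))
    (cw : ∀ R > (0 : ℝ), Tendsto (fun s => ∫ y in Metric.ball (0 : EuclideanSpace ℝ (Fin n)) R,
      ‖w s y - wb y‖ ^ 2) atTop (𝓝 0)) :
    Tendsto (fun s => ∫ y, ⟪L s y (w s y), φ y⟫) atTop (𝓝 (∫ y, ⟪Lb y (wb y), φ y⟫)) := by
  obtain ⟨R, hR, hsub⟩ := hc.isCompact.isBounded.subset_ball_lt 0 0
  obtain ⟨K1, hK1⟩ := (isCompact_closedBall (0 : EuclideanSpace ℝ (Fin n)) R).exists_bound_of_continuousOn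
    hLb.continuousOn
  obtain ⟨K2, hK2⟩ := (isCompact_closedBall (0 : EuclideanSpace ℝ (Fin n)) R).exists_bound_of_continuousOn
    hwb.continuousOn
  obtain ⟨K3, hK3⟩ := (isCompact_closedBall (0 : EuclideanSpace ℝ (Fin n)) R).exists_bound_of_continuousOn
    hφ.continuousOn
  obtain ⟨K, hK0, h1, h2, h3⟩ : ∃ K : ℝ, 1 ≤ K ∧ K1 ≤ K ∧ K2 ≤ K ∧ K3 ≤ K :=
    ⟨max 1 (max K1 (max K2 K3)), by simp, by simp, by simp, by simp⟩
  set S := Metric.ball (0 : EuclideanSpace ℝ (Fin n)) R with hS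
  have hfin : volume S ≠ ⊤ := measure_ball_lt_top.ne
  have intS : ∀ f : EuclideanSpace ℝ (Fin n) → ℝ, Continuous f → IntegrableOn f S := fun f hf =>
    (hf.continuousOn.integrableOn_compact (isCompact_closedBall 0 R)).mono_set
      Metric.ball_subset_closedBall
  set p := fun s => ∫ y in S, ‖L s y - Lb y‖ ^ 2 with hp
  set q := fun s => ∫ y in S, ‖w s y - wb y‖ ^ 2 with hq
  have bound : ∀ ε > 0, ∀ s, |(∫ y, ⟪L s y (w s y), φ y⟫) - ∫ y, ⟪Lb y (wb y), φ y⟫| ≤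
      K ^ 2 * (1 + 1 / ε) * (p s + q s) + 2 * K ^ 2 * ε * (volume S).toReal := by
    intro ε hε s
    have e1 : (∫ y, ⟪L s y (w s y), φ y⟫) - ∫ y, ⟪Lb y (wb y), φ y⟫
        = ∫ y in S, (⟪L s y (w s y), φ y⟫ - ⟪Lb y (wb y), φ y⟫) := by
      rw [← integral_sub (aux_int ((hL s).clm_apply (hw s)) hφ hc) (aux_int (hLb.clm_apply hwb) hφ hc)]
      symm
      apply setIntegral_eq_integral_of_forall_compl_eq_zero
      intro y hy
      have : φ y = 0 := image_eq_zero_of_notMem_tsupport fun h => hy (hsub h)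
      simp [this]
    have ip := intS (fun y => ‖L s y - Lb y‖ ^ 2) (((hL s).sub hLb).norm.pow 2)
    have iq := intS (fun y => ‖w s y - wb y‖ ^ 2) (((hw s).sub hwb).norm.pow 2)
    rw [e1, ← Real.norm_eq_abs]
    have e2 : K ^ 2 * (1 + 1 / ε) * (p s + q s) + 2 * K ^ 2 * ε * (volume S).toReal
        = ∫ y in S, (K ^ 2 * (1 + 1 / ε) * (‖L s y - Lb y‖ ^ 2 + ‖w s y - wb y‖ ^ 2)
          + 2 * K ^ 2 * ε) := by
      have ipq : IntegrableOn (fun y => ‖L s y - Lb y‖ ^ 2 + ‖w s y - wb y‖ ^ 2) S := ip.add iq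
      rw [integral_add (ipq.const_mul _) (integrableOn_const hfin), integral_const_mul,
        integral_add ip iq]
      simp [Measure.real, mul_comm]
      exact Or.inl rfl
    rw [e2]
    refine norm_integral_le_of_norm_le (((ip.add iq).const_mul _).add (integrableOn_const hfin)) ?_
    refine (ae_restrict_iff' Metric.isOpen_ball.measurableSet).2 (Eventually.of_forall fun y hy => ?_)
    have hy' := Metric.ball_subset_closedBall hy
    have b1 := (hK1 y hy').trans h1
    have b2 := (hK2 y hy').trans h2
    have b3 := (hK3 y hy').trans h3
    have sp : ∀ a : ℝ, 0 ≤ a → a ≤ ε + a ^ 2 / ε := by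
      intro a ha
      rw [← sub_nonneg]
      have : ε + a ^ 2 / ε - a = (ε ^ 2 + a ^ 2 - a * ε) / ε := by field_simp
      rw [this]
      apply div_nonneg _ hε.le
      nlinarith [sq_nonneg (a - ε), sq_nonneg a, sq_nonneg ε]
    have dec : L s y (w s y) - Lb y (wb y) = (L s y - Lb y) (w s y - wb y)
        + Lb y (w s y - wb y) + (L s y - Lb y) (wb y) := by
      simp only [map_sub, sub_apply]; abel
    rw [← inner_sub_left]
    have n1 : ‖L s y (w s y) - Lb y (wb y)‖ ≤ ‖L s y - Lb y‖ * ‖w s y - wb y‖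
        + ‖Lb y‖ * ‖w s y - wb y‖ + ‖L s y - Lb y‖ * ‖wb y‖ := by
      rw [dec]
      exact norm_add₃_le.trans (add_le_add (add_le_add (ContinuousLinearMap.le_opNorm _ _)
        (ContinuousLinearMap.le_opNorm _ _)) (ContinuousLinearMap.le_opNorm _ _))
    set a := ‖L s y - Lb y‖
    set b := ‖w s y - wb y‖
    have ha : 0 ≤ a := norm_nonneg _
    have hb : 0 ≤ b := norm_nonneg _
    have n2 : ‖L s y (w s y) - Lb y (wb y)‖ ≤ K * (a ^ 2 + b ^ 2 + a + b) := by
      have t1 : ‖Lb y‖ * b ≤ K * b := by gcongr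
      have t2 : a * ‖wb y‖ ≤ a * K := by gcongr
      have t3 : a * b ≤ K * (a ^ 2 + b ^ 2) := by
        nlinarith [sq_nonneg (a - b), sq_nonneg a, sq_nonneg b]
      nlinarith
    have n3 : a ^ 2 + b ^ 2 + a + b ≤ (1 + 1 / ε) * (a ^ 2 + b ^ 2) + 2 * ε := by
      have := sp a ha
      have := sp b hb
      have : (1 + 1 / ε) * (a ^ 2 + b ^ 2) = a ^ 2 + b ^ 2 + a ^ 2 / ε + b ^ 2 / ε := by ring
      linarith
    calc ‖⟪L s y (w s y) - Lb y (wb y), φ y⟫‖ ≤ ‖L s y (w s y) - Lb y (wb y)‖ * ‖φ y‖ :=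
          norm_inner_le_norm _ _
      _ ≤ (K * ((1 + 1 / ε) * (a ^ 2 + b ^ 2) + 2 * ε)) * K := by
          gcongr
          exact n2.trans (by gcongr)
      _ = _ := by ring
  rw [Metric.tendsto_atTop']
  intro δ hδ
  have hpq : Tendsto (fun s => p s + q s) atTop (𝓝 0) := by simpa using (cL R hR).add (cw R hR)
  set m := (volume S).toReal
  have hm : 0 ≤ m := ENNReal.toReal_nonneg
  set ε := δ / (4 * K ^ 2 * (m + 1)) with hε
  have hε0 : 0 < ε := by positivity
  have h0 : 2 * K ^ 2 * ε * m < δ := by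
    have : 2 * K ^ 2 * ε * (m + 1) = δ / 2 := by rw [hε]; field_simp; norm_num
    have : 2 * K ^ 2 * ε * m ≤ 2 * K ^ 2 * ε * (m + 1) := by gcongr; linarith
    linarith
  have ht : Tendsto (fun s => K ^ 2 * (1 + 1 / ε) * (p s + q s) + 2 * K ^ 2 * ε * m) atTop
      (𝓝 (2 * K ^ 2 * ε * m)) := by
    simpa using (hpq.const_mul (K ^ 2 * (1 + 1 / ε))).add_const (2 * K ^ 2 * ε * m)
  obtain ⟨N, hN⟩ := eventually_atTop.1 (ht.eventually_lt_const h0)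
  exact ⟨N, fun s hs => (bound ε hε0 s).trans_lt (hN s hs.le)⟩

lemma aux_elap {n : ℕ} {f φ : EuclideanSpace ℝ (Fin n) → EuclideanSpace ℝ (Fin n)}
    (hf : ContDiff ℝ 2 f) (hφ : ContDiff ℝ 1 φ) (hc : HasCompactSupport φ) :
    Continuous (elap f) ∧ ∫ y, ⟪elap f y, φ y⟫ =
      - ∑ i, ∫ y, ⟪fderiv ℝ f y (EuclideanSpace.single i 1),
        fderiv ℝ φ y (EuclideanSpace.single i 1)⟫ := by
  have hg : ∀ i : Fin n, ContDiff ℝ 1 (fun y => fderiv ℝ f y (EuclideanSpace.single i (1 : ℝ))) :=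
    fun i => (hf.fderiv_right (m := 1) (by norm_num)).clm_apply contDiff_const
  have hgc : ∀ i : Fin n, Continuous (fun x => fderiv ℝ (fun y => fderiv ℝ f y
      (EuclideanSpace.single i (1 : ℝ))) x (EuclideanSpace.single i 1)) := fun i =>
    ((hg i).continuous_fderiv (by norm_num)).clm_apply continuous_const
  have hφc : ∀ i : Fin n, Continuous (fun x => fderiv ℝ φ x (EuclideanSpace.single i (1 : ℝ))) :=
    fun i => (hφ.continuous_fderiv (by norm_num)).clm_apply continuous_const
  refine ⟨continuous_finsetSum _ fun i _ => hgc i, ?_⟩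
  simp only [elap, sum_inner]
  rw [integral_finsetSum _ fun i _ => aux_int (hgc i) hφ.continuous hc, ← Finset.sum_neg_distrib]
  refine Finset.sum_congr rfl fun i _ => ?_
  have := integral_bilinear_fderiv_right_eq_neg_left_of_integrable (μ := volume)
    (B := innerSL ℝ) (f := fun y => fderiv ℝ f y (EuclideanSpace.single i (1 : ℝ))) (g := φ)
    (v := EuclideanSpace.single i (1 : ℝ)) (aux_int (hgc i) hφ.continuous hc)
    (aux_int (hg i).continuous (hφc i) (hc.fderiv_apply (𝕜 := ℝ) _))
    (aux_int (hg i).continuous hφ.continuous hc)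
    (fun x _ => (hg i).differentiable (by norm_num) x)
    (fun x _ => hφ.differentiable (by norm_num) x)
  have h2 : ∫ y, ⟪fderiv ℝ f y (EuclideanSpace.single i 1),
        fderiv ℝ φ y (EuclideanSpace.single i 1)⟫ = - ∫ y, ⟪fderiv ℝ (fun y => fderiv ℝ f y
      (EuclideanSpace.single i (1 : ℝ))) y (EuclideanSpace.single i 1), φ y⟫ := this
  rw [h2, neg_neg]

lemma aux_grad {n : ℕ} {P : EuclideanSpace ℝ (Fin n) → ℝ}
    {φ : EuclideanSpace ℝ (Fin n) → EuclideanSpace ℝ (Fin n)}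
    (hP : ContDiff ℝ 2 P) (hφ : ContDiff ℝ 1 φ) (hc : HasCompactSupport φ)
    (hdiv : ∀ x, ediv φ x = 0) :
    Continuous (gradient P) ∧ ∫ y, ⟪gradient P y, φ y⟫ = 0 := by
  have hPc := hP.continuous_fderiv (by norm_num)
  refine ⟨(InnerProductSpace.toDual ℝ _).symm.continuous.comp hPc, ?_⟩
  simp only [inner_gradient_left]
  have e1 : ∀ y, fderiv ℝ P y (φ y) =
      ∑ i, fderiv ℝ P y (EuclideanSpace.single i 1) * φ y i := by
    intro y
    conv_lhs => rw [← (EuclideanSpace.basisFun (Fin n) ℝ).sum_repr (φ y)]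
    simp [map_sum, mul_comm]
  have hφi : ∀ i, ContDiff ℝ 1 (fun y => φ y i) := fun i =>
    (EuclideanSpace.proj (𝕜 := ℝ) i).contDiff.comp hφ
  have hfi : ∀ i y v, fderiv ℝ (fun y => φ y i) y v = fderiv ℝ φ y v i := by
    intro i y v
    have h := (EuclideanSpace.proj (𝕜 := ℝ) i).hasFDerivAt.comp y
      ((hφ.differentiable (by norm_num)) y).hasFDerivAt
    have h' : HasFDerivAt (fun y => φ y i) _ y := h
    rw [h'.fderiv]; rfl
  have hci : ∀ i, HasCompactSupport (fun y => φ y i) := fun i =>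
    hc.comp_left (g := fun v : EuclideanSpace ℝ (Fin n) => v i) rfl
  have i1 : ∀ i, Integrable (fun y => fderiv ℝ P y (EuclideanSpace.single i 1) * φ y i) := fun i =>
    ((hPc.clm_apply continuous_const).mul (hφi i).continuous).integrable_of_hasCompactSupport
      (hci i).mul_left
  have i2 : ∀ i, Integrable (fun y => P y * fderiv ℝ (fun y => φ y i) y (EuclideanSpace.single i 1)) :=
    fun i => (hP.continuous.mul (((hφi i).continuous_fderiv (by norm_num)).clm_apply
      continuous_const)).integrable_of_hasCompactSupport ((hci i).fderiv_apply (𝕜 := ℝ) _).mul_left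
  have i3 : ∀ i, Integrable (fun y => P y * φ y i) := fun i =>
    (hP.continuous.mul (hφi i).continuous).integrable_of_hasCompactSupport (hci i).mul_left
  simp only [e1]
  rw [integral_finsetSum _ fun i _ => i1 i]
  have e2 : ∀ i, ∫ y, fderiv ℝ P y (EuclideanSpace.single i 1) * φ y i =
      - ∫ y, P y * fderiv ℝ (fun y => φ y i) y (EuclideanSpace.single i 1) := by
    intro i
    rw [integral_mul_fderiv_eq_neg_fderiv_mul_of_integrable (i1 i) (i2 i) (i3 i)
      (fun x _ => hP.differentiable (by norm_num) x)
      (fun x _ => (hφi i).differentiable (by norm_num) x), neg_neg]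
  simp only [e2]
  rw [Finset.sum_neg_distrib, ← integral_finsetSum _ fun i _ => i2 i]
  simp only [← Finset.mul_sum, hfi]
  have : ∀ y, ∑ i, fderiv ℝ φ y (EuclideanSpace.single i 1) i = 0 := hdiv
  simp [this]

/-- if `(V,B)` solves the self-similar MHD evolution system and
`V(·,s) → V̄`, `B(·,s) → B̄` in `H¹(B_R)` for every `R > 0` as `s → ∞`, then
`(V̄,B̄)` is a weak (distributional) solution of the stationary system. -/
theorem stmt18 (n : ℕ) (ν : ℝ) (hν : 0 < ν)
    (V B : ℝ → EuclideanSpace ℝ (Fin n) → EuclideanSpace ℝ (Fin n))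
    (P' : ℝ → EuclideanSpace ℝ (Fin n) → ℝ)
    (hVreg : ContDiff ℝ 2 (fun q : ℝ × EuclideanSpace ℝ (Fin n) => V q.1 q.2))
    (hBreg : ContDiff ℝ 2 (fun q : ℝ × EuclideanSpace ℝ (Fin n) => B q.1 q.2))
    (hP'reg : ContDiff ℝ 2 (fun q : ℝ × EuclideanSpace ℝ (Fin n) => P' q.1 q.2))
    (hsys : ∀ s ∈ Set.Ici (0 : ℝ), ∀ y,
      ((1 / 2 : ℝ) • deriv (fun σ => V σ y) s + (1 / 2 : ℝ) • V s y
          + (1 / 2 : ℝ) • fderiv ℝ (V s) y y + fderiv ℝ (V s) y (V s y)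
          = ν • elap (V s) y + fderiv ℝ (B s) y (B s y) - gradient (P' s) y)
        ∧ ((1 / 2 : ℝ) • deriv (fun σ => B σ y) s + (1 / 2 : ℝ) • B s y
            + (1 / 2 : ℝ) • fderiv ℝ (B s) y y + fderiv ℝ (B s) y (V s y)
            = fderiv ℝ (V s) y (B s y))
        ∧ ediv (V s) y = 0 ∧ ediv (B s) y = 0)
    (Vb Bb : EuclideanSpace ℝ (Fin n) → EuclideanSpace ℝ (Fin n))
    (hVb : ContDiff ℝ 1 Vb) (hBb : ContDiff ℝ 1 Bb)
    (hconv : ∀ R > (0 : ℝ),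
      Tendsto (fun s => ∫ y in Metric.ball (0 : EuclideanSpace ℝ (Fin n)) R,
          (‖V s y - Vb y‖ ^ 2 + ‖fderiv ℝ (V s) y - fderiv ℝ Vb y‖ ^ 2
            + ‖B s y - Bb y‖ ^ 2 + ‖fderiv ℝ (B s) y - fderiv ℝ Bb y‖ ^ 2))
        atTop (𝓝 0)) :
    (∀ φ : EuclideanSpace ℝ (Fin n) → EuclideanSpace ℝ (Fin n),
      ContDiff ℝ 1 φ → HasCompactSupport φ → (∀ x, ediv φ x = 0) →
      (∫ y, ⟪Vb y + fderiv ℝ Vb y y + (2 : ℝ) • fderiv ℝ Vb y (Vb y)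
          - (2 : ℝ) • fderiv ℝ Bb y (Bb y), φ y⟫)
        + 2 * ν * ∫ y, ∑ i, ⟪fderiv ℝ Vb y (EuclideanSpace.single i 1),
            fderiv ℝ φ y (EuclideanSpace.single i 1)⟫ = 0)
    ∧ (∀ ψ : EuclideanSpace ℝ (Fin n) → ℝ,
      ContDiff ℝ 1 ψ → HasCompactSupport ψ →
      (∫ y, ψ y • (Bb y + fderiv ℝ Bb y y + (2 : ℝ) • fderiv ℝ Bb y (Vb y)
          - (2 : ℝ) • fderiv ℝ Vb y (Bb y))) = (0 : EuclideanSpace ℝ (Fin n))) := by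
  
  have hslice : ∀ {W : ℝ → EuclideanSpace ℝ (Fin n) → EuclideanSpace ℝ (Fin n)},
      ContDiff ℝ 2 (fun q : ℝ × EuclideanSpace ℝ (Fin n) => W q.1 q.2) → ∀ s, ContDiff ℝ 2 (W s) :=
    fun hW s => hW.comp (contDiff_prodMk_right s)
  have hV := hslice hVreg
  have hB := hslice hBreg
  have hP : ∀ s, ContDiff ℝ 2 (P' s) := fun s => hP'reg.comp (contDiff_prodMk_right s)
  have hVc := fun s => (hV s).continuous
  have hBc := fun s => (hB s).continuous
  have hDV := fun s => (hV s).continuous_fderiv (by norm_num)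
  have hDB := fun s => (hB s).continuous_fderiv (by norm_num)
  have hVbc := hVb.continuous
  have hBbc := hBb.continuous
  have hDVb := hVb.continuous_fderiv (by norm_num)
  have hDBb := hBb.continuous_fderiv (by norm_num)
  have sq : ∀ f : ℝ → EuclideanSpace ℝ (Fin n) → ℝ, (∀ s, Continuous (f s)) → (∀ s y, 0 ≤ f s y) →
      (∀ s y, f s y ≤ ‖V s y - Vb y‖ ^ 2 + ‖fderiv ℝ (V s) y - fderiv ℝ Vb y‖ ^ 2
            + ‖B s y - Bb y‖ ^ 2 + ‖fderiv ℝ (B s) y - fderiv ℝ Bb y‖ ^ 2) →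
      ∀ R > (0 : ℝ), Tendsto (fun s => ∫ y in Metric.ball (0 : EuclideanSpace ℝ (Fin n)) R, f s y)
        atTop (𝓝 0) := by
    intro f hf h0 hle R hR
    have intS : ∀ f : EuclideanSpace ℝ (Fin n) → ℝ, Continuous f →
        IntegrableOn f (Metric.ball (0 : EuclideanSpace ℝ (Fin n)) R) := fun f hf =>
      (hf.continuousOn.integrableOn_compact (isCompact_closedBall 0 R)).mono_set
        Metric.ball_subset_closedBall
    refine squeeze_zero (fun s => integral_nonneg (h0 s)) (fun s => ?_) (hconv R hR)
    refine integral_mono (intS _ (hf s)) (intS _ ?_) (hle s)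
    exact (((((hVc s).sub hVbc).norm.pow 2).add (((hDV s).sub hDVb).norm.pow 2)).add
      (((hBc s).sub hBbc).norm.pow 2)).add (((hDB s).sub hDBb).norm.pow 2)
  have cV := sq (fun s y => ‖V s y - Vb y‖ ^ 2) (fun s => ((hVc s).sub hVbc).norm.pow 2)
    (fun s y => by positivity) (fun s y => by
      have := sq_nonneg ‖fderiv ℝ (V s) y - fderiv ℝ Vb y‖
      have := sq_nonneg ‖B s y - Bb y‖
      have := sq_nonneg ‖fderiv ℝ (B s) y - fderiv ℝ Bb y‖
      linarith)
  have cB := sq (fun s y => ‖B s y - Bb y‖ ^ 2) (fun s => ((hBc s).sub hBbc).norm.pow 2)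
    (fun s y => by positivity) (fun s y => by
      have := sq_nonneg ‖fderiv ℝ (V s) y - fderiv ℝ Vb y‖
      have := sq_nonneg ‖V s y - Vb y‖
      have := sq_nonneg ‖fderiv ℝ (B s) y - fderiv ℝ Bb y‖
      linarith)
  have cDV := sq (fun s y => ‖fderiv ℝ (V s) y - fderiv ℝ Vb y‖ ^ 2)
    (fun s => ((hDV s).sub hDVb).norm.pow 2)
    (fun s y => by positivity) (fun s y => by
      have := sq_nonneg ‖V s y - Vb y‖
      have := sq_nonneg ‖B s y - Bb y‖
      have := sq_nonneg ‖fderiv ℝ (B s) y - fderiv ℝ Bb y‖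
      linarith)
  have cDB := sq (fun s y => ‖fderiv ℝ (B s) y - fderiv ℝ Bb y‖ ^ 2)
    (fun s => ((hDB s).sub hDBb).norm.pow 2)
    (fun s y => by positivity) (fun s y => by
      have := sq_nonneg ‖V s y - Vb y‖
      have := sq_nonneg ‖B s y - Bb y‖
      have := sq_nonneg ‖fderiv ℝ (V s) y - fderiv ℝ Vb y‖
      linarith)
  -- convergence of the pieces
  have t1 : ∀ {W : ℝ → EuclideanSpace ℝ (Fin n) → EuclideanSpace ℝ (Fin n)}
      {Wb φ : EuclideanSpace ℝ (Fin n) → EuclideanSpace ℝ (Fin n)},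
      (∀ s, Continuous (W s)) → Continuous Wb → Continuous φ → HasCompactSupport φ →
      (∀ R > (0 : ℝ), Tendsto (fun s => ∫ y in Metric.ball (0 : EuclideanSpace ℝ (Fin n)) R,
        ‖W s y - Wb y‖ ^ 2) atTop (𝓝 0)) →
      Tendsto (fun s => ∫ y, ⟪W s y, φ y⟫) atTop (𝓝 (∫ y, ⟪Wb y, φ y⟫)) := by
    intro W Wb φ hW hWb hφ hc h
    exact aux_tendsto (L := fun _ _ => ContinuousLinearMap.id ℝ _)
      (Lb := fun _ => ContinuousLinearMap.id ℝ _) (fun _ => continuous_const) hW continuous_const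
      hWb hφ hc (fun R hR => by simp) h
  have t2 : ∀ {L : ℝ → EuclideanSpace ℝ (Fin n) →
        EuclideanSpace ℝ (Fin n) →L[ℝ] EuclideanSpace ℝ (Fin n)}
      {Lb : EuclideanSpace ℝ (Fin n) → EuclideanSpace ℝ (Fin n) →L[ℝ] EuclideanSpace ℝ (Fin n)}
      {w φ : EuclideanSpace ℝ (Fin n) → EuclideanSpace ℝ (Fin n)},
      (∀ s, Continuous (L s)) → Continuous Lb → Continuous w → Continuous φ → HasCompactSupport φ →
      (∀ R > (0 : ℝ), Tendsto (fun s => ∫ y in Metric.ball (0 : EuclideanSpace ℝ (Fin n)) R,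
        ‖L s y - Lb y‖ ^ 2) atTop (𝓝 0)) →
      Tendsto (fun s => ∫ y, ⟪L s y (w y), φ y⟫) atTop (𝓝 (∫ y, ⟪Lb y (w y), φ y⟫)) := by
    intro L Lb w φ hL hLb hw hφ hc h
    exact aux_tendsto (w := fun _ => w) hL (fun _ => hw) hLb hw hφ hc h (fun R hR => by simp)
  -- splitting
  have split : ∀ {a b c d φ : EuclideanSpace ℝ (Fin n) → EuclideanSpace ℝ (Fin n)},
      Continuous a → Continuous b → Continuous c → Continuous d → Continuous φ →
      HasCompactSupport φ →
      ∫ y, ⟪a y + b y + (2 : ℝ) • c y - (2 : ℝ) • d y, φ y⟫ =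
        (∫ y, ⟪a y, φ y⟫) + (∫ y, ⟪b y, φ y⟫) + 2 * (∫ y, ⟪c y, φ y⟫) - 2 * ∫ y, ⟪d y, φ y⟫ := by
    intro a b c d φ ha hb hc hd hφ hcs
    have ia := aux_int ha hφ hcs
    have ib := aux_int hb hφ hcs
    have ic := (aux_int hc hφ hcs).const_mul 2
    have id := (aux_int hd hφ hcs).const_mul 2
    have iab : Integrable (fun y => ⟪a y, φ y⟫ + ⟪b y, φ y⟫) := ia.add ib
    have iabc : Integrable (fun y => ⟪a y, φ y⟫ + ⟪b y, φ y⟫ + 2 * ⟪c y, φ y⟫) := iab.add ic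
    simp only [inner_sub_left, inner_add_left, real_inner_smul_left]
    rw [integral_sub iabc id, integral_add iab ic, integral_add ia ib, integral_const_mul,
      integral_const_mul]
  constructor
  · intro φ hφ hc hdiv
    have hφc := hφ.continuous
    have hφi : ∀ i : Fin n, Continuous (fun x => fderiv ℝ φ x (EuclideanSpace.single i (1 : ℝ))) :=
      fun i => (hφ.continuous_fderiv (by norm_num)).clm_apply continuous_const
    have hci : ∀ i : Fin n, HasCompactSupport
      (fun x => fderiv ℝ φ x (EuclideanSpace.single i (1 : ℝ))) := fun i =>
        hc.fderiv_apply (𝕜 := ℝ) _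
    rw [split hVbc (hDVb.clm_apply continuous_id') (hDVb.clm_apply hVbc) (hDBb.clm_apply hBbc) hφc hc,
      integral_finsetSum _ fun i _ => aux_int (hDVb.clm_apply continuous_const) (hφi i) (hci i)]
    have lim := (((((t1 hVc hVbc hφc hc cV).add (t2 hDV hDVb continuous_id' hφc hc cDV)).add
      ((aux_tendsto hDV hVc hDVb hVbc hφc hc cDV cV).const_mul 2)).sub
      ((aux_tendsto hDB hBc hDBb hBbc hφc hc cDB cB).const_mul 2)).add
      ((tendsto_finsetSum (Finset.univ : Finset (Fin n)) fun i _ =>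
        t2 (w := fun _ => EuclideanSpace.single i (1 : ℝ)) hDV hDVb continuous_const
          (hφi i) (hci i) cDV).const_mul (2 * ν))).neg
    refine neg_eq_zero.1 (aux_limit ?_ (t1 hVc hVbc hφc hc cV) lim)
    intro s hs
    have hd := aux_deriv hVreg hφc hc s
    convert! hd using 1
    obtain ⟨hel, hel2⟩ := aux_elap (hV s) hφ hc
    obtain ⟨hgr, hgr2⟩ := aux_grad (hP s) hφ hc hdiv
    have e : ∀ y, deriv (fun σ => V σ y) s = (2 * ν) • elap (V s) y - (2 : ℝ) • gradient (P' s) y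
        - (V s y + fderiv ℝ (V s) y y + (2 : ℝ) • fderiv ℝ (V s) y (V s y)
          - (2 : ℝ) • fderiv ℝ (B s) y (B s y)) := by
      intro y
      have h := (hsys s hs.le y).1
      have h2 := congrArg (fun z => (2 : ℝ) • z) h
      simp only [smul_add, smul_sub, smul_smul] at h2
      norm_num at h2
      rw [eq_sub_iff_add_eq, ← sub_eq_zero]
      rw [← sub_eq_zero] at h2
      rw [← h2]
      abel
    have j0 := aux_int ((((hVc s).add ((hDV s).clm_apply continuous_id')).add
      (((hDV s).clm_apply (hVc s)).const_smul (2 : ℝ))).sub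
      (((hDB s).clm_apply (hBc s)).const_smul (2 : ℝ))) hφc hc
    have j1 := aux_int ((hel.const_smul (2 * ν)).sub (hgr.const_smul (2 : ℝ))) hφc hc
    have k0 := split (hVc s) ((hDV s).clm_apply continuous_id') ((hDV s).clm_apply (hVc s))
      ((hDB s).clm_apply (hBc s)) hφc hc
    have e3 : ∫ y, ⟪(2 * ν) • elap (V s) y - (2 : ℝ) • gradient (P' s) y, φ y⟫ =
        2 * ν * ∫ y, ⟪elap (V s) y, φ y⟫ := by
      simp only [inner_sub_left, real_inner_smul_left]
      rw [integral_sub ((aux_int hel hφc hc).const_mul _) ((aux_int hgr hφc hc).const_mul _),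
        integral_const_mul, integral_const_mul, hgr2]
      ring
    simp only [e, inner_sub_left (_ - _) (_ - _)]
    have e4 := integral_sub j1 j0
    refine Eq.trans ?_ e4.symm
    refine Eq.trans ?_ (congrArg₂ (· - ·) e3.symm k0.symm)
    rw [hel2]
    ring
  · intro ψ hψ hcψ
    refine ext_inner_right ℝ fun v => ?_
    have hc : HasCompactSupport (fun y => ψ y • v) := hcψ.smul_right
    have hφc : Continuous (fun y => ψ y • v) := hψ.continuous.smul continuous_const
    have hX : Continuous (fun y => Bb y + fderiv ℝ Bb y y + (2 : ℝ) • fderiv ℝ Bb y (Vb y)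
          - (2 : ℝ) • fderiv ℝ Vb y (Bb y)) :=
      ((hBbc.add (hDBb.clm_apply continuous_id')).add
      ((hDBb.clm_apply hVbc).const_smul (2 : ℝ))).sub
      ((hDVb.clm_apply hBbc).const_smul (2 : ℝ))
    have hint : Integrable (fun y => ψ y • (Bb y + fderiv ℝ Bb y y + (2 : ℝ) • fderiv ℝ Bb y (Vb y)
          - (2 : ℝ) • fderiv ℝ Vb y (Bb y))) :=
      (hψ.continuous.smul hX).integrable_of_hasCompactSupport hcψ.smul_right
    rw [inner_zero_left, real_inner_comm, ← integral_inner hint v]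
    have e0 : ∀ y, ⟪v, ψ y • (Bb y + fderiv ℝ Bb y y + (2 : ℝ) • fderiv ℝ Bb y (Vb y)
          - (2 : ℝ) • fderiv ℝ Vb y (Bb y))⟫ = ⟪Bb y + fderiv ℝ Bb y y
          + (2 : ℝ) • fderiv ℝ Bb y (Vb y) - (2 : ℝ) • fderiv ℝ Vb y (Bb y), ψ y • v⟫ := by
      intro y
      rw [real_inner_smul_right, real_inner_smul_right, real_inner_comm]
    simp only [e0]
    rw [split hBbc (hDBb.clm_apply continuous_id') (hDBb.clm_apply hVbc) (hDVb.clm_apply hBbc) hφc hc]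
    have lim := ((((t1 hBc hBbc hφc hc cB).add (t2 hDB hDBb continuous_id' hφc hc cDB)).add
      ((aux_tendsto hDB hVc hDBb hVbc hφc hc cDB cV).const_mul 2)).sub
      ((aux_tendsto hDV hBc hDVb hBbc hφc hc cDV cB).const_mul 2)).neg
    refine neg_eq_zero.1 (aux_limit ?_ (t1 hBc hBbc hφc hc cB) lim)
    intro s hs
    have hd := aux_deriv hBreg hφc hc s
    convert! hd using 1
    have e : ∀ y, deriv (fun σ => B σ y) s =
        - (B s y + fderiv ℝ (B s) y y + (2 : ℝ) • fderiv ℝ (B s) y (V s y)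
          - (2 : ℝ) • fderiv ℝ (V s) y (B s y)) := by
      intro y
      have h := (hsys s hs.le y).2.1
      have h2 := congrArg (fun z => (2 : ℝ) • z) h
      simp only [smul_add, smul_smul] at h2
      norm_num at h2
      rw [← h2]
      abel
    simp only [e, inner_neg_left]
    rw [integral_neg, split (hBc s) ((hDB s).clm_apply continuous_id') ((hDB s).clm_apply (hVc s))
      ((hDV s).clm_apply (hBc s)) hφc hc]
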